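/- For all integers p, q, r, s ≥ 3, there is no witness Gabriel drawing of the complete 4-partite graph K_{p,q,r,s}: there do not exist a finite set P ⊆ ℝ², a finite set W ⊆ ℝ² with P ∪ W in general position, and a coloring c : P → Fin 4 whose four color classes have sizes p, q, r, s, such that distinct a, b ∈ P are adjacent in GG⁻(P,W) if and only if c(a) ≠ c(b). -/

import Mathlib

open scoped RealInnerProductSpace

noncomputable section

/-- The Euclidean plane. -/
abbrev Pt := EuclideanSpace ℝ (Fin 2)

/-- The closed disk with diameter `ab`. -/
def diskD (a b : Pt) : Set Pt := Metric.closedBall (midpoint ℝ a b) (dist a b / 2)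

/-- `a` and `b` are adjacent in the witness Gabriel graph with witness set `W`. -/
def gabrielEdge (W : Set Pt) (a b : Pt) : Prop := (diskD a b \ {a, b}) ∩ W = ∅

/-- General position: no three points collinear, no four points concyclic. -/
def GenPos (S : Set Pt) : Prop :=
  (∀ a ∈ S, ∀ b ∈ S, ∀ c ∈ S, a ≠ b → a ≠ c → b ≠ c → ¬ Collinear ℝ ({a, b, c} : Set Pt)) ∧
  (∀ a ∈ S, ∀ b ∈ S, ∀ c ∈ S, ∀ d ∈ S, a ≠ b → a ≠ c → a ≠ d → b ≠ c → b ≠ d → c ≠ d →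
    ¬ EuclideanGeometry.Cospherical ({a, b, c, d} : Set Pt))

/-- Planar determinant `u₁v₂ − u₂v₁`. -/
def det2 (u v : Pt) : ℝ := u 0 * v 1 - u 1 * v 0

/-- Counterclockwise convex position. -/
def CCWConvexPos {m : ℕ} (q : Fin m → Pt) : Prop :=
  ∀ i j k : Fin m, i < j → j < k → 0 < det2 (q j - q i) (q k - q i)

/-- Cyclic successor in `Fin m`. -/
def cyclicSucc {m : ℕ} (hm : 0 < m) (i : Fin m) : Fin m :=
  ⟨((i : ℕ) + 1) % m, Nat.mod_lt _ hm⟩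


/-- Coordinates in the four axis directions. -/
def co {ι : Type*} (X Y : ι → ℝ) (k : Fin 4) (x : ι) : ℝ :=
  if k = 0 then X x else if k = 1 then Y x else if k = 2 then - X x else - Y x

def StrictAt {ι : Type*} (P : Set ι) (c : ι → Fin 4) (X Y : ι → ℝ) (i k : Fin 4) : Prop :=
  ∃ a ∈ P, c a = i ∧ ∀ x ∈ P, c x ≠ i → co X Y k a < co X Y k x

def CornerAt {ι : Type*} (P : Set ι) (c : ι → Fin 4) (X Y : ι → ℝ) (i k : Fin 4) : Prop :=
  ∃ z ∈ P, ∃ u ∈ P, ∃ v ∈ P, c z ≠ i ∧ c u = i ∧ c v = i ∧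
    (∀ x ∈ P, co X Y k z ≤ co X Y k x) ∧ (∀ x ∈ P, co X Y (k+1) z ≤ co X Y (k+1) x) ∧
    co X Y k u = co X Y k z ∧ co X Y (k+1) v = co X Y (k+1) z

def PairAt {ι : Type*} (P : Set ι) (c : ι → Fin 4) (X Y : ι → ℝ) (a b : ι) : Prop :=
  ∃ n1 n2 m1 m2 : ℝ, (n1 ≠ 0 ∨ n2 ≠ 0) ∧ (m1 ≠ 0 ∨ m2 ≠ 0) ∧ n1 * m1 + n2 * m2 = 0 ∧
    (∀ x ∈ P, c x ≠ c a → 0 ≤ n1 * (X x - X a) + n2 * (Y x - Y a)) ∧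
    (∀ x ∈ P, c x ≠ c a → 0 ≤ m1 * (X x - X b) + m2 * (Y x - Y b)) ∧
    ((∀ x ∈ P, c x ≠ c a → 0 < m1 * (X x - X b) + m2 * (Y x - Y b)) ∨
      ∃ w ∈ P, c w ≠ c a ∧ n1 = X b - X w ∧ n2 = Y b - Y w ∧ m1 = X a - X w ∧ m2 = Y a - Y w)

lemma co0 {ι : Type*} (X Y : ι → ℝ) (x : ι) : co X Y 0 x = X x := by simp [co]
lemma co1 {ι : Type*} (X Y : ι → ℝ) (x : ι) : co X Y 1 x = Y x := by simp [co]
lemma co2 {ι : Type*} (X Y : ι → ℝ) (x : ι) : co X Y 2 x = - X x := by simp [co]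
lemma co3 {ι : Type*} (X Y : ι → ℝ) (x : ι) : co X Y 3 x = - Y x := by simp [co]

lemma strict_of_two {ι : Type*} (P : Set ι) (c : ι → Fin 4) (X Y : ι → ℝ)
    (hinj : ∀ x ∈ P, ∀ y ∈ P, X x = X y → Y x = Y y → x = y)
    (a : ι) (ha : a ∈ P) (n1 n2 m1 m2 : ℝ)
    (hn : ∀ x ∈ P, c x ≠ c a → 0 ≤ n1 * (X x - X a) + n2 * (Y x - Y a))
    (hm : ∀ x ∈ P, c x ≠ c a → 0 ≤ m1 * (X x - X a) + m2 * (Y x - Y a))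
    (h1 : 0 < n1 * n2) (h2 : m1 * m2 < 0) : ∃ k, StrictAt P c X Y (c a) k := by
  have key : ∀ x ∈ P, c x ≠ c a → ∀ p q : ℝ, 0 < p → 0 < q →
      0 < p * (n1 * (X x - X a) + n2 * (Y x - Y a)) + q * (m1 * (X x - X a) + m2 * (Y x - Y a)) := by
    intro x hx hc p q hp hq
    have e1 := hn x hx hc
    have e2 := hm x hx hc
    rcases e1.lt_or_eq with e1 | e1
    · have := mul_pos hp e1
      have := mul_nonneg hq.le e2
      linarith
    rcases e2.lt_or_eq with e2 | e2
    · have := mul_pos hq e2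
      rw [← e1]; linarith
    exfalso
    apply hc
    have hd : n1 * m2 - n2 * m1 ≠ 0 := by
      intro h
      have : (n1 * n2) * m2^2 = n2^2 * (m1 * m2) := by
        have : n1 * m2 = n2 * m1 := by linarith
        calc (n1 * n2) * m2^2 = (n1 * m2) * (n2 * m2) := by ring
          _ = _ := by rw [this]; ring
      have hm2 : m2 ≠ 0 := by rintro rfl; simp at h2
      have : 0 < (n1 * n2) * m2^2 := by positivity
      nlinarith [sq_nonneg n2]
    have hX : X x - X a = 0 := by
      apply (mul_eq_zero.mp (_ : (n1 * m2 - n2 * m1) * (X x - X a) = 0)).resolve_left hd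
      linear_combination n2 * e2 - m2 * e1
    have hY : Y x - Y a = 0 := by
      apply (mul_eq_zero.mp (_ : (n1 * m2 - n2 * m1) * (Y x - Y a) = 0)).resolve_left hd
      linear_combination m1 * e1 - n1 * e2
    rw [hinj x hx a ha (by linarith) (by linarith)]
  have fin : ∀ p q : ℝ, 0 < p → 0 < q →
      (p * n1 + q * m1 = 0 ∧ p * n2 + q * m2 ≠ 0 ∨ p * n2 + q * m2 = 0 ∧ p * n1 + q * m1 ≠ 0) →
      ∃ k, StrictAt P c X Y (c a) k := by
    intro p q hp hq h
    rcases h with ⟨h0, h⟩ | ⟨h0, h⟩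
    · have key2 : ∀ x ∈ P, c x ≠ c a → 0 < (p * n2 + q * m2) * (Y x - Y a) := by
        intro x hx hc
        have := key x hx hc p q hp hq
        have e : (p * n2 + q * m2) * (Y x - Y a) = p * (n1 * (X x - X a) + n2 * (Y x - Y a)) + q * (m1 * (X x - X a) + m2 * (Y x - Y a)) := by
          linear_combination - (X x - X a) * h0
        rw [e]; exact this
      rcases lt_or_gt_of_ne h with h | h
      · refine ⟨3, a, ha, rfl, fun x hx hc => ?_⟩
        rw [co3, co3]; have := key2 x hx hc; nlinarith
      · refine ⟨1, a, ha, rfl, fun x hx hc => ?_⟩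
        rw [co1, co1]; have := key2 x hx hc; nlinarith
    · have key2 : ∀ x ∈ P, c x ≠ c a → 0 < (p * n1 + q * m1) * (X x - X a) := by
        intro x hx hc
        have := key x hx hc p q hp hq
        have e : (p * n1 + q * m1) * (X x - X a) = p * (n1 * (X x - X a) + n2 * (Y x - Y a)) + q * (m1 * (X x - X a) + m2 * (Y x - Y a)) := by
          linear_combination - (Y x - Y a) * h0
        rw [e]; exact this
      rcases lt_or_gt_of_ne h with h | h
      · refine ⟨2, a, ha, rfl, fun x hx hc => ?_⟩
        rw [co2, co2]; have := key2 x hx hc; nlinarith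
      · refine ⟨0, a, ha, rfl, fun x hx hc => ?_⟩
        rw [co0, co0]; have := key2 x hx hc; nlinarith
  rcases mul_pos_iff.mp h1 with ⟨a1, a2⟩ | ⟨a1, a2⟩ <;> rcases mul_neg_iff.mp h2 with ⟨b1, b2⟩ | ⟨b1, b2⟩
  · exact fin (-m2) n2 (by linarith) a2 (Or.inr ⟨by ring, by nlinarith⟩)
  · exact fin (-m1) n1 (by linarith) a1 (Or.inl ⟨by ring, by nlinarith⟩)
  · exact fin (m1) (-n1) (by linarith) (by linarith) (Or.inl ⟨by ring, by nlinarith⟩)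
  · exact fin (m2) (-n2) (by linarith) (by linarith) (Or.inr ⟨by ring, by nlinarith⟩)

lemma strict_of_axis {ι : Type*} (P : Set ι) (c : ι → Fin 4) (X Y : ι → ℝ)
    (a : ι) (ha : a ∈ P) (m1 m2 : ℝ) (hne : m1 ≠ 0 ∨ m2 ≠ 0) (h : m1 * m2 = 0)
    (hm : ∀ x ∈ P, c x ≠ c a → 0 < m1 * (X x - X a) + m2 * (Y x - Y a)) :
    ∃ k, StrictAt P c X Y (c a) k := by
  rcases mul_eq_zero.mp h with h0 | h0
  · have h : m2 ≠ 0 := hne.resolve_left (by simp [h0])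
    rcases lt_or_gt_of_ne h with h | h
    · refine ⟨3, a, ha, rfl, fun x hx hc => ?_⟩
      rw [co3, co3]; have := hm x hx hc; rw [h0] at this; nlinarith
    · refine ⟨1, a, ha, rfl, fun x hx hc => ?_⟩
      rw [co1, co1]; have := hm x hx hc; rw [h0] at this; nlinarith
  · have h : m1 ≠ 0 := hne.resolve_right (by simp [h0])
    rcases lt_or_gt_of_ne h with h | h
    · refine ⟨2, a, ha, rfl, fun x hx hc => ?_⟩
      rw [co2, co2]; have := hm x hx hc; rw [h0] at this; nlinarith
    · refine ⟨0, a, ha, rfl, fun x hx hc => ?_⟩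
      rw [co0, co0]; have := hm x hx hc; rw [h0] at this; nlinarith

/-- a corner candidate is strict or a corner -/
lemma corner_core {ι : Type*} (P : Set ι) (c : ι → Fin 4) (X Y : ι → ℝ) (i k : Fin 4)
    (z u v : ι) (hz : z ∈ P) (hu : u ∈ P) (hv : v ∈ P) (cz : c z ≠ i) (cu : c u = i) (cv : c v = i)
    (h1 : ∀ x ∈ P, c x ≠ i → co X Y k z ≤ co X Y k x)
    (h2 : ∀ x ∈ P, c x ≠ i → co X Y (k+1) z ≤ co X Y (k+1) x)
    (h3 : co X Y k u = co X Y k z) (h4 : co X Y (k+1) v = co X Y (k+1) z) :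
    (∃ k, StrictAt P c X Y i k) ∨ ∃ k, CornerAt P c X Y i k := by
  by_cases hs : ∃ k, StrictAt P c X Y i k
  · exact Or.inl hs
  refine Or.inr ⟨k, z, hz, u, hu, v, hv, cz, cu, cv, ?_, ?_, h3, h4⟩
  · intro x hx
    by_contra hlt
    by_cases hc : c x = i
    · exact hs ⟨k, x, hx, hc, fun y hy hyc => lt_of_lt_of_le (not_le.mp hlt) (h1 y hy hyc)⟩
    · exact hlt (h1 x hx hc)
  · intro x hx
    by_contra hlt
    by_cases hc : c x = i
    · exact hs ⟨k+1, x, hx, hc, fun y hy hyc => lt_of_lt_of_le (not_le.mp hlt) (h2 y hy hyc)⟩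
    · exact hlt (h2 x hx hc)

lemma pair_axis {ι : Type*} (P : Set ι) (c : ι → Fin 4) (X Y : ι → ℝ)
    (a b : ι) (ha : a ∈ P) (hb : b ∈ P) (hab : c a = c b) (n1 n2 m1 m2 : ℝ)
    (hn0 : n1 ≠ 0 ∨ n2 ≠ 0) (hm0 : m1 ≠ 0 ∨ m2 ≠ 0) (hort : n1 * m1 + n2 * m2 = 0)
    (hn : ∀ x ∈ P, c x ≠ c a → 0 ≤ n1 * (X x - X a) + n2 * (Y x - Y a))
    (hm : ∀ x ∈ P, c x ≠ c a → 0 ≤ m1 * (X x - X b) + m2 * (Y x - Y b))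
    (hor : (∀ x ∈ P, c x ≠ c a → 0 < m1 * (X x - X b) + m2 * (Y x - Y b)) ∨
      ∃ w ∈ P, c w ≠ c a ∧ n1 = X b - X w ∧ n2 = Y b - Y w ∧ m1 = X a - X w ∧ m2 = Y a - Y w)
    (hax : n1 * n2 = 0) :
    (∃ k, StrictAt P c X Y (c a) k) ∨ ∃ k, CornerAt P c X Y (c a) k := by
  have hax2 : m1 * m2 = 0 := by
    rcases mul_eq_zero.mp hax with h | h
    · have h' : n2 ≠ 0 := hn0.resolve_left (by simp [h])
      rw [h] at hort; simp [h'] at hort; simp [hort]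
    · have h' : n1 ≠ 0 := hn0.resolve_right (by simp [h])
      rw [h] at hort; simp [h'] at hort; simp [hort]
  rcases hor with hs | ⟨w, hw, cw, e1, e2, e3, e4⟩
  · left
    have := strict_of_axis P c X Y b hb m1 m2 hm0 hax2 (by rw [← hab]; exact hs)
    rwa [← hab] at this
  · rcases mul_eq_zero.mp hax with h | h
    · have h' : n2 ≠ 0 := hn0.resolve_left (by simp [h])
      have g : m2 = 0 := by rw [h] at hort; simpa [h'] using hort
      have g' : m1 ≠ 0 := hm0.resolve_right (by simp [g])
      rw [h] at hn; rw [g] at hm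
      have ex : X b = X w := by linarith
      have ey : Y a = Y w := by linarith
      rcases lt_or_gt_of_ne h' with h' | h' <;> rcases lt_or_gt_of_ne g' with g' | g'
      · refine corner_core P c X Y (c a) 2 w b a hw hb ha cw hab.symm rfl ?_ ?_ ?_ ?_ <;>
          simp only [co2, co3, show (2:Fin 4)+1 = 3 from rfl, ex, ey]
        · intro x hx hc; have := hm x hx hc; nlinarith
        · intro x hx hc; have := hn x hx hc; nlinarith
      · refine corner_core P c X Y (c a) 3 w a b hw ha hb cw rfl hab.symm ?_ ?_ ?_ ?_ <;>
          simp only [co3, co0, show (3:Fin 4)+1 = 0 from rfl, ex, ey]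
        · intro x hx hc; have := hn x hx hc; nlinarith
        · intro x hx hc; have := hm x hx hc; nlinarith
      · refine corner_core P c X Y (c a) 1 w a b hw ha hb cw rfl hab.symm ?_ ?_ ?_ ?_ <;>
          simp only [co1, co2, show (1:Fin 4)+1 = 2 from rfl, ex, ey]
        · intro x hx hc; have := hn x hx hc; nlinarith
        · intro x hx hc; have := hm x hx hc; nlinarith
      · refine corner_core P c X Y (c a) 0 w b a hw hb ha cw hab.symm rfl ?_ ?_ ?_ ?_ <;>
          simp only [co0, co1, show (0:Fin 4)+1 = 1 from rfl, ex, ey]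
        · intro x hx hc; have := hm x hx hc; nlinarith
        · intro x hx hc; have := hn x hx hc; nlinarith
    · have h' : n1 ≠ 0 := hn0.resolve_right (by simp [h])
      have g : m1 = 0 := by rw [h] at hort; simpa [h'] using hort
      have g' : m2 ≠ 0 := hm0.resolve_left (by simp [g])
      rw [h] at hn; rw [g] at hm
      have ey : Y b = Y w := by linarith
      have ex : X a = X w := by linarith
      rcases lt_or_gt_of_ne h' with h' | h' <;> rcases lt_or_gt_of_ne g' with g' | g'
      · refine corner_core P c X Y (c a) 2 w a b hw ha hb cw rfl hab.symm ?_ ?_ ?_ ?_ <;>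
          simp only [co2, co3, show (2:Fin 4)+1 = 3 from rfl, ex, ey]
        · intro x hx hc; have := hn x hx hc; nlinarith
        · intro x hx hc; have := hm x hx hc; nlinarith
      · refine corner_core P c X Y (c a) 1 w b a hw hb ha cw hab.symm rfl ?_ ?_ ?_ ?_ <;>
          simp only [co1, co2, show (1:Fin 4)+1 = 2 from rfl, ex, ey]
        · intro x hx hc; have := hm x hx hc; nlinarith
        · intro x hx hc; have := hn x hx hc; nlinarith
      · refine corner_core P c X Y (c a) 3 w b a hw hb ha cw hab.symm rfl ?_ ?_ ?_ ?_ <;>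
          simp only [co3, co0, show (3:Fin 4)+1 = 0 from rfl, ex, ey]
        · intro x hx hc; have := hm x hx hc; nlinarith
        · intro x hx hc; have := hn x hx hc; nlinarith
      · refine corner_core P c X Y (c a) 0 w a b hw ha hb cw rfl hab.symm ?_ ?_ ?_ ?_ <;>
          simp only [co0, co1, show (0:Fin 4)+1 = 1 from rfl, ex, ey]
        · intro x hx hc; have := hn x hx hc; nlinarith
        · intro x hx hc; have := hm x hx hc; nlinarith

lemma ort_sign (n1 n2 m1 m2 : ℝ) (hm0 : m1 ≠ 0 ∨ m2 ≠ 0)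
    (hort : n1 * m1 + n2 * m2 = 0) (hax : n1 * n2 ≠ 0) : (n1 * n2) * (m1 * m2) < 0 := by
  have e : (n1 * n2) * (m1 * m2) = - (n1 * m1)^2 := by
    linear_combination (n1 * m1) * hort
  rw [e]
  have h1 : n1 ≠ 0 := left_ne_zero_of_mul hax
  have h2 : n2 ≠ 0 := right_ne_zero_of_mul hax
  have h3 : m1 ≠ 0 := by
    rintro rfl
    simp [h2] at hort
    simp [hort] at hm0
  have : 0 < (n1 * m1)^2 := by positivity
  linarith

lemma class_lemma {ι : Type*} (P : Set ι) (c : ι → Fin 4) (X Y : ι → ℝ)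
    (hinj : ∀ x ∈ P, ∀ y ∈ P, X x = X y → Y x = Y y → x = y)
    (a b d : ι) (ha : a ∈ P) (hb : b ∈ P) (hd : d ∈ P) (hab : c a = c b) (hbd : c b = c d)
    (p1 : PairAt P c X Y a b) (p2 : PairAt P c X Y b d) (p3 : PairAt P c X Y d a) :
    (∃ k, StrictAt P c X Y (c a) k) ∨ ∃ k, CornerAt P c X Y (c a) k := by
  obtain ⟨n1, n2, m1, m2, n0, m0, o, hn, hm, hor⟩ := p1
  obtain ⟨n1', n2', m1', m2', n0', m0', o', hn', hm', hor'⟩ := p2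
  obtain ⟨n1'', n2'', m1'', m2'', n0'', m0'', o'', hn'', hm'', hor''⟩ := p3
  by_cases A : n1 * n2 = 0
  · exact pair_axis P c X Y a b ha hb hab _ _ _ _ n0 m0 o hn hm hor A
  by_cases A' : n1' * n2' = 0
  · have := pair_axis P c X Y b d hb hd hbd _ _ _ _ n0' m0' o' hn' hm' hor' A'
    rwa [← hab] at this
  by_cases A'' : n1'' * n2'' = 0
  · have := pair_axis P c X Y d a hd ha (by rw [hab, hbd]) _ _ _ _ n0'' m0'' o'' hn'' hm'' hor'' A''
    rwa [← hbd, ← hab] at this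
  have s := ort_sign _ _ _ _ m0 o A
  have s' := ort_sign _ _ _ _ m0' o' A'
  have s'' := ort_sign _ _ _ _ m0'' o'' A''
  left
  -- generic: two normals at the same point with opposite signs
  have gen : ∀ e ∈ P, c e = c a → ∀ u1 u2 v1 v2 : ℝ,
      (∀ x ∈ P, c x ≠ c a → 0 ≤ u1 * (X x - X e) + u2 * (Y x - Y e)) →
      (∀ x ∈ P, c x ≠ c a → 0 ≤ v1 * (X x - X e) + v2 * (Y x - Y e)) →
      (u1 * u2) * (v1 * v2) < 0 → ∃ k, StrictAt P c X Y (c a) k := by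
    intro e he hc u1 u2 v1 v2 hu hv huv
    rw [← hc] at hu hv ⊢
    rcases mul_neg_iff.mp huv with ⟨h1, h2⟩ | ⟨h1, h2⟩
    · exact strict_of_two P c X Y hinj e he u1 u2 v1 v2 hu hv h1 h2
    · exact strict_of_two P c X Y hinj e he v1 v2 u1 u2 hv hu h2 h1
  have cb : c b = c a := hab.symm
  have cd : c d = c a := by rw [hab, hbd]
  rw [cb] at hn' hm'
  rw [cd] at hn'' hm''
  by_cases B1 : (n1 * n2) * (m1'' * m2'') < 0
  · exact gen a ha rfl _ _ _ _ hn hm'' B1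
  by_cases B2 : (n1' * n2') * (m1 * m2) < 0
  · exact gen b hb cb _ _ _ _ hn' hm B2
  by_cases B3 : (n1'' * n2'') * (m1' * m2') < 0
  · exact gen d hd cd _ _ _ _ hn'' hm' B3
  exfalso
  push Not at B1 B2 B3
  have t1 := mul_pos_of_neg_of_neg s s'
  have t2 := mul_neg_of_pos_of_neg t1 s''
  have t3 := mul_nonneg (mul_nonneg B1 B2) B3
  nlinarith

/-- conflict between two types -/
def cfl (s t : Bool × Fin 4) : Bool :=
  if s.1 = t.1 then decide (s.2 = t.2)
  else if s.1 then decide (s.2 = t.2) || decide (s.2 = t.2 + 1)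
  else decide (t.2 = s.2) || decide (t.2 = s.2 + 1)

set_option synthInstance.maxHeartbeats 400000 in
set_option synthInstance.maxSize 2000 in
set_option maxRecDepth 20000 in
lemma combi2 : ∀ (b0 : Bool) (k0 : Fin 4) (b1 : Bool) (k1 : Fin 4), cfl (b0,k0) (b1,k1) = false →
    ∀ (b2 : Bool) (k2 : Fin 4), cfl (b0,k0) (b2,k2) = false → cfl (b1,k1) (b2,k2) = false →
    ∀ (b3 : Bool) (k3 : Fin 4), cfl (b0,k0) (b3,k3) = false → cfl (b1,k1) (b3,k3) = false →
      cfl (b2,k2) (b3,k3) = false →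
      (b0 = b1 ∧ b0 = b2 ∧ b0 = b3 ∧ ∀ k, k = k0 ∨ k = k1 ∨ k = k2 ∨ k = k3) := by
  decide

def TypeAt {ι : Type*} (P : Set ι) (c : ι → Fin 4) (X Y : ι → ℝ) (i : Fin 4) (t : Bool × Fin 4) : Prop :=
  if t.1 then StrictAt P c X Y i t.2 else CornerAt P c X Y i t.2

lemma ss_conf {ι : Type*} (P : Set ι) (c : ι → Fin 4) (X Y : ι → ℝ) (i j k : Fin 4) (hij : i ≠ j)
    (h1 : StrictAt P c X Y i k) (h2 : StrictAt P c X Y j k) : False := by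
  obtain ⟨a, ha, ca, h1⟩ := h1
  obtain ⟨b, hb, cb, h2⟩ := h2
  have := h1 b hb (by rw [cb]; exact hij.symm)
  have := h2 a ha (by rw [ca]; exact hij)
  linarith

lemma sc_conf {ι : Type*} (P : Set ι) (c : ι → Fin 4) (X Y : ι → ℝ) (i j k l : Fin 4) (hij : i ≠ j)
    (h1 : StrictAt P c X Y i k) (h2 : CornerAt P c X Y j l) (h : k = l ∨ k = l + 1) : False := by
  obtain ⟨a, ha, ca, h1⟩ := h1
  obtain ⟨z, hz, u, hu, v, hv, cz, cu, cv, e1, e2, e3, e4⟩ := h2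
  rcases h with rfl | rfl
  · have := h1 u hu (by rw [cu]; exact hij.symm)
    have := e1 a ha
    linarith
  · have := h1 v hv (by rw [cv]; exact hij.symm)
    have := e2 a ha
    linarith

lemma co_inj {ι : Type*} (X Y : ι → ℝ) (k : Fin 4) (x y : ι) (h1 : co X Y k x = co X Y k y)
    (h2 : co X Y (k+1) x = co X Y (k+1) y) : X x = X y ∧ Y x = Y y := by
  fin_cases k <;> simp [co] at h1 h2 <;> simp [h1, h2]

lemma cc_conf {ι : Type*} (P : Set ι) (c : ι → Fin 4) (X Y : ι → ℝ) (i j k : Fin 4) (hij : i ≠ j)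
    (hinj : ∀ x ∈ P, ∀ y ∈ P, X x = X y → Y x = Y y → x = y)
    (hcol : ∀ k, ∀ x ∈ P, ∀ y ∈ P, ∀ z ∈ P, x ≠ y → x ≠ z → y ≠ z →
      co X Y k x = co X Y k y → co X Y k x = co X Y k z → False)
    (h1 : CornerAt P c X Y i k) (h2 : CornerAt P c X Y j k) : False := by
  obtain ⟨z, hz, u, hu, v, hv, cz, cu, cv, e1, e2, e3, e4⟩ := h1
  obtain ⟨z', hz', u', hu', v', hv', cz', cu', cv', e1', e2', e3', e4'⟩ := h2
  have a1 := le_antisymm (e1 z' hz') (e1' z hz)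
  have a2 := le_antisymm (e2 z' hz') (e2' z hz)
  obtain ⟨b1, b2⟩ := co_inj X Y k z z' a1 a2
  have := hinj z hz z' hz' b1 b2
  subst this
  refine hcol k z hz u hu u' hu' ?_ ?_ ?_ e3.symm e3'.symm
  · rintro rfl; exact cz cu
  · rintro rfl; exact cz' cu'
  · rintro rfl; exact hij (cu.symm.trans cu')

lemma frame_lemma {ι : Type*} (P : Set ι) (c : ι → Fin 4) (X Y : ι → ℝ)
    (hinj : ∀ x ∈ P, ∀ y ∈ P, X x = X y → Y x = Y y → x = y)
    (hcol : ∀ k, ∀ x ∈ P, ∀ y ∈ P, ∀ z ∈ P, x ≠ y → x ≠ z → y ≠ z →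
      co X Y k x = co X Y k y → co X Y k x = co X Y k z → False)
    (hrect : ∀ z0 ∈ P, ∀ z1 ∈ P, ∀ z2 ∈ P, ∀ z3 ∈ P, X z0 < X z1 → Y z0 < Y z2 →
      X z3 = X z0 → X z2 = X z1 → Y z1 = Y z0 → Y z3 = Y z2 → False)
    (h3 : ∃ x ∈ P, ∃ y ∈ P, ∃ z ∈ P, x ≠ y ∧ x ≠ z ∧ y ≠ z)
    (H : ∀ i, (∃ k, StrictAt P c X Y i k) ∨ ∃ k, CornerAt P c X Y i k) :
    (∀ i, ∃ k, StrictAt P c X Y i k) ∧ ∀ k, ∃ i, StrictAt P c X Y i k := by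
  have H' : ∀ i, ∃ b : Bool, ∃ k, TypeAt P c X Y i (b, k) := by
    intro i
    rcases H i with ⟨k, h⟩ | ⟨k, h⟩
    · exact ⟨true, k, by simpa [TypeAt] using h⟩
    · exact ⟨false, k, by simpa [TypeAt] using h⟩
  choose b k hbk using H'
  have conf : ∀ i j, i ≠ j → cfl (b i, k i) (b j, k j) = false := by
    intro i j hij
    by_contra hc
    have hi := hbk i
    have hj := hbk j
    cases hbi : b i <;> cases hbj : b j <;> simp [cfl, TypeAt, hbi, hbj] at hc hi hj
    · rw [hc] at hi; exact cc_conf P c X Y i j _ hij hinj hcol hi hj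
    · exact sc_conf P c X Y j i _ _ hij.symm hj hi (or_iff_not_imp_left.mpr hc)
    · exact sc_conf P c X Y i j _ _ hij hi hj (or_iff_not_imp_left.mpr hc)
    · rw [hc] at hi; exact ss_conf P c X Y i j _ hij hi hj
  obtain ⟨q1, q2, q3, q4⟩ := combi2 _ _ _ _ (conf 0 1 (by decide)) _ _ (conf 0 2 (by decide)) (conf 1 2 (by decide))
    _ _ (conf 0 3 (by decide)) (conf 1 3 (by decide)) (conf 2 3 (by decide))
  have hb : ∀ i, b i = b 0 := by
    intro i; fin_cases i <;> simp [← q1, ← q2, ← q3]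
  have hk : ∀ l, ∃ i, l = k i := by
    intro l
    rcases q4 l with h | h | h | h
    · exact ⟨_, h⟩
    · exact ⟨_, h⟩
    · exact ⟨_, h⟩
    · exact ⟨_, h⟩
  cases h0 : b 0 with
  | true =>
    have hs : ∀ i, StrictAt P c X Y i (k i) := by
      intro i; have := hbk i; simpa [TypeAt, hb i, h0] using this
    refine ⟨fun i => ⟨_, hs i⟩, fun l => ?_⟩
    obtain ⟨i, rfl⟩ := hk l
    exact ⟨i, hs i⟩
  | false =>
    exfalso
    have hs : ∀ i, CornerAt P c X Y i (k i) := by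
      intro i; have := hbk i; simpa [TypeAt, hb i, h0] using this
    have hz : ∀ l, ∃ z ∈ P, (∀ x ∈ P, co X Y l z ≤ co X Y l x) ∧ (∀ x ∈ P, co X Y (l+1) z ≤ co X Y (l+1) x) := by
      intro l
      obtain ⟨i, rfl⟩ := hk l
      obtain ⟨z, hz, u, hu, v, hv, cz, cu, cv, e1, e2, e3, e4⟩ := hs i
      exact ⟨z, hz, e1, e2⟩
    obtain ⟨z0, m0, a0, b0⟩ := hz 0
    obtain ⟨z1, m1, a1, b1⟩ := hz 1
    obtain ⟨z2, m2, a2, b2⟩ := hz 2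
    obtain ⟨z3, m3, a3, b3⟩ := hz 3
    rw [show (0:Fin 4) + 1 = 1 from rfl] at b0
    rw [show (1:Fin 4) + 1 = 2 from rfl] at b1
    rw [show (2:Fin 4) + 1 = 3 from rfl] at b2
    rw [show (3:Fin 4) + 1 = 0 from rfl] at b3
    simp only [co0, co1, co2, co3, neg_le_neg_iff] at a0 b0 a1 b1 a2 b2 a3 b3
    obtain ⟨x, hx, y, hy, z, hz, xy, xz, yz⟩ := h3
    refine hrect z0 m0 z1 m1 z2 m2 z3 m3 ?_ ?_ (le_antisymm (b3 _ m0) (a0 _ m3)) (le_antisymm (b1 _ m2) (a2 _ m1))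
      (le_antisymm (a1 _ m0) (b0 _ m1)) (le_antisymm (b2 _ m3) (a3 _ m2))
    · by_contra hlt
      have : ∀ x ∈ P, X x = X z0 := fun x hx => le_antisymm ((b1 x hx).trans (not_lt.mp hlt)) (a0 x hx)
      refine hcol 0 x hx y hy z hz xy xz yz ?_ ?_ <;> simp [co0, this x hx, this y hy, this z hz]
    · by_contra hlt
      have : ∀ x ∈ P, Y x = Y z0 := fun x hx => le_antisymm ((b2 x hx).trans (not_lt.mp hlt)) (b0 x hx)
      refine hcol 1 x hx y hy z hz xy xz yz ?_ ?_ <;> simp [co1, this x hx, this y hy, this z hz]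

/-- planar dot product seen from `w` -/
def dt (a b w : Pt) : ℝ := (a 0 - w 0) * (b 0 - w 0) + (a 1 - w 1) * (b 1 - w 1)

lemma mem_diskD (a b w : Pt) : w ∈ diskD a b ↔ dt a b w ≤ 0 := by
  unfold diskD dt
  rw [Metric.mem_closedBall, EuclideanSpace.dist_eq, EuclideanSpace.dist_eq, Fin.sum_univ_two,
    Fin.sum_univ_two, Real.dist_eq, Real.dist_eq, Real.dist_eq, Real.dist_eq]
  simp only [sq_abs]
  have e : ∀ i, (midpoint ℝ a b) i = (a i + b i) / 2 := by
    intro i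
    rw [midpoint_eq_smul_add]
    simp
    ring
  rw [e, e, Real.sqrt_le_left (by positivity), div_pow, Real.sq_sqrt (by positivity)]
  constructor <;> intro h <;> nlinarith

lemma collinear_of_cross (a b c : Pt) (hab : a ≠ b)
    (h : (b 0 - a 0) * (c 1 - a 1) = (b 1 - a 1) * (c 0 - a 0)) : Collinear ℝ ({a, b, c} : Set Pt) := by
  rw [collinear_iff_of_mem (p₀ := a) (by simp)]
  refine ⟨b - a, ?_⟩
  have : b 0 - a 0 ≠ 0 ∨ b 1 - a 1 ≠ 0 := by
    by_contra hh
    push Not at hh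
    apply hab
    ext i
    fin_cases i
    · simp; linarith [hh.1]
    · simp; linarith [hh.2]
  intro p hp
  simp only [Set.mem_insert_iff, Set.mem_singleton_iff] at hp
  rcases hp with rfl | rfl | rfl
  · exact ⟨0, by simp⟩
  · exact ⟨1, by simp⟩
  · rcases this with h0 | h0
    · refine ⟨(p 0 - a 0) / (b 0 - a 0), ?_⟩
      ext i
      fin_cases i
      · simp; field_simp; ring
      · simp; field_simp; linear_combination h
    · refine ⟨(p 1 - a 1) / (b 1 - a 1), ?_⟩
      ext i
      fin_cases i
      · simp; field_simp; linear_combination -h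
      · simp; field_simp; ring

lemma dt_comm (a b w : Pt) : dt a b w = dt b a w := by unfold dt; ring

/-- drawing properties -/
def Drawing (P W : Finset Pt) (c : Pt → Fin 4) : Prop :=
  (∀ a ∈ P, ∀ b ∈ P, a ≠ b → (gabrielEdge (W : Set Pt) a b ↔ c a ≠ c b))

lemma edge_iff (W : Set Pt) (a b : Pt) :
    gabrielEdge W a b ↔ ∀ w ∈ W, w ≠ a → w ≠ b → 0 < dt a b w := by
  unfold gabrielEdge
  rw [Set.eq_empty_iff_forall_notMem]
  constructor
  · intro h w hw ha hb
    by_contra hc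
    exact h w ⟨⟨(mem_diskD a b w).mpr (not_lt.mp hc), by simp [ha, hb]⟩, hw⟩
  · rintro h w ⟨⟨h1, h2⟩, hw⟩
    simp at h2
    have := h w hw h2.1 h2.2
    rw [mem_diskD] at h1
    linarith

lemma pair_of_drawing (P W : Finset Pt) (c : Pt → Fin 4)
    (hG : GenPos ((P : Set Pt) ∪ (W : Set Pt))) (hD : Drawing P W c) (X Y : Pt → ℝ)
    (hdot : ∀ a b w, (X a - X w) * (X b - X w) + (Y a - Y w) * (Y b - Y w) = dt a b w)
    (hcr : ∀ a b c, (X b - X a) * (Y c - Y a) = (Y b - Y a) * (X c - X a) →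
      a ≠ b → Collinear ℝ ({a, b, c} : Set Pt))
    (hinj : ∀ x y, X x = X y → Y x = Y y → x = y)
    (a b : Pt) (ha : a ∈ P) (hb : b ∈ P) (hab : a ≠ b) (hc : c a = c b) :
    PairAt (P : Set Pt) c X Y a b := by
  have h1 : ¬ gabrielEdge (W : Set Pt) a b := fun h => (hD a ha b hb hab).mp h hc
  rw [edge_iff] at h1
  push Not at h1
  obtain ⟨w, hw, wa, wb, hle⟩ := h1
  have hpos : ∀ e ∈ P, c e = c a → w ≠ e → ∀ x ∈ P, c x ≠ c a → x ≠ w → 0 < dt x e w := by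
    intro e he ce we x hx cx xw
    have xe : x ≠ e := by rintro rfl; exact cx ce
    have := (hD x hx e he xe).mpr (by rw [ce]; exact cx)
    rw [edge_iff] at this
    exact this w hw xw.symm we
  have hnn : ∀ e ∈ P, c e = c a → w ≠ e → ∀ x ∈ P, c x ≠ c a → 0 ≤ dt x e w := by
    intro e he ce we x hx cx
    by_cases xw : x = w
    · subst xw; simp [dt]
    · exact (hpos e he ce we x hx cx xw).le
  have A := hpos a ha rfl wa
  have A' := hnn a ha rfl wa
  have B' := hnn b hb hc.symm wb
  simp only [← hdot] at A A' B' hle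
  have hnc : (X a - X w) * (Y b - Y w) ≠ (Y a - Y w) * (X b - X w) := by
    intro h
    exact hG.1 w (Or.inr hw) a (Or.inl ha) b (Or.inl hb) wa wb hab (hcr w a b h wa)
  have hm0 : X a - X w ≠ 0 ∨ Y a - Y w ≠ 0 := by
    by_contra h
    push Not at h
    exact wa (hinj w a (by linarith [h.1]) (by linarith [h.2]))
  generalize hp : X a - X w = p at *
  generalize hq : Y a - Y w = q at *
  generalize hr : X b - X w = r at *
  generalize hs : Y b - Y w = s at *
  have hN : 0 < p * p + q * q := by
    rcases hm0 with h | h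
    · have := mul_self_pos.mpr h; nlinarith [mul_self_nonneg q]
    · have := mul_self_pos.mpr h; nlinarith [mul_self_nonneg p]
  obtain ⟨l, hl⟩ : ∃ l, l = -(p * r + q * s) / (p * p + q * q) := ⟨_, rfl⟩
  have hl0 : 0 ≤ l := by rw [hl]; apply div_nonneg <;> linarith
  have hl1 : l * (p * p + q * q) = -(p * r + q * s) := by rw [hl]; exact div_mul_cancel₀ _ hN.ne'
  refine ⟨r + l * p, s + l * q, p, q, ?_, hm0, by linear_combination hl1, ?_, ?_, ?_⟩
  · by_contra h
    push Not at h
    apply hnc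
    linear_combination p * h.2 - q * h.1
  · intro x hx cx
    have e1 := A' x hx cx
    have e2 := B' x hx cx
    have e3 := mul_nonneg hl0 e1
    have : (r + l * p) * (X x - X a) + (s + l * q) * (Y x - Y a) =
      ((X x - X w) * r + (Y x - Y w) * s) + l * ((X x - X w) * p + (Y x - Y w) * q) := by
      rw [show X x - X a = X x - X w - p by linarith, show Y x - Y a = Y x - Y w - q by linarith]
      linear_combination -hl1
    rw [this]; linarith
  · intro x hx cx
    have e1 := A' x hx cx
    rw [show X x - X b = X x - X w - r by linarith, show Y x - Y b = Y x - Y w - s by linarith]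
    linarith
  · by_cases hcase : w ∈ P ∧ c w ≠ c a ∧ l = 0
    · right
      obtain ⟨c1, c2, c3⟩ := hcase
      exact ⟨w, c1, c2, by rw [c3, hr]; ring, by rw [c3, hs]; ring, hp.symm, hq.symm⟩
    · left
      intro x hx cx
      rw [show X x - X b = X x - X w - r by linarith, show Y x - Y b = Y x - Y w - s by linarith]
      by_cases xw : x = w
      · subst xw
        have : 0 < l := lt_of_le_of_ne hl0 (fun h => hcase ⟨hx, cx, h.symm⟩)
        have := mul_pos this hN
        linarith
      · have := A x hx cx xw
        linarith

lemma on_circle (a b w : Pt) (h : dt a b w = 0) : dist w (midpoint ℝ a b) = dist a b / 2 := by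
  unfold dt at h
  rw [EuclideanSpace.dist_eq, EuclideanSpace.dist_eq, Fin.sum_univ_two,
    Fin.sum_univ_two, Real.dist_eq, Real.dist_eq, Real.dist_eq, Real.dist_eq]
  simp only [sq_abs]
  have e : ∀ i, (midpoint ℝ a b) i = (a i + b i) / 2 := by
    intro i
    rw [midpoint_eq_smul_add]
    simp
    ring
  rw [e, e, Real.sqrt_eq_iff_mul_self_eq (by positivity) (by positivity), div_mul_div_comm,
    Real.mul_self_sqrt (by positivity)]
  nlinarith

/-- rotated coordinates -/
def fX (t : ℝ) (x : Pt) : ℝ := Real.cos t * x 0 + Real.sin t * x 1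

def fY (t : ℝ) (x : Pt) : ℝ := - Real.sin t * x 0 + Real.cos t * x 1

lemma fdot (t : ℝ) (a b w : Pt) :
    (fX t a - fX t w) * (fX t b - fX t w) + (fY t a - fY t w) * (fY t b - fY t w) = dt a b w := by
  unfold fX fY dt
  linear_combination ((a 0 - w 0) * (b 0 - w 0) + (a 1 - w 1) * (b 1 - w 1)) * Real.sin_sq_add_cos_sq t

lemma fcr (t : ℝ) (a b c : Pt)
    (h : (fX t b - fX t a) * (fY t c - fY t a) = (fY t b - fY t a) * (fX t c - fX t a)) (hab : a ≠ b) :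
    Collinear ℝ ({a, b, c} : Set Pt) := by
  apply collinear_of_cross a b c hab
  unfold fX fY at h
  linear_combination h - ((b 0 - a 0) * (c 1 - a 1) - (b 1 - a 1) * (c 0 - a 0)) * Real.sin_sq_add_cos_sq t

lemma finj (t : ℝ) (x y : Pt) (h1 : fX t x = fX t y) (h2 : fY t x = fY t y) : x = y := by
  unfold fX at h1
  unfold fY at h2
  have e := Real.sin_sq_add_cos_sq t
  ext i
  fin_cases i
  · show x 0 = y 0
    linear_combination Real.cos t * h1 - Real.sin t * h2 - (x 0 - y 0) * e
  · show x 1 = y 1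
    linear_combination Real.sin t * h1 + Real.cos t * h2 - (x 1 - y 1) * e

lemma f_shift (t : ℝ) (k : Fin 4) (x : Pt) :
    co (fX t) (fY t) k x = fX (t + (k : ℕ) * (Real.pi / 2)) x := by
  fin_cases k
  · simp [co]
  · simp [co, fX, fY, Real.cos_add_pi_div_two, Real.sin_add_pi_div_two]
  · have : t + ((2 : ℕ) : ℝ) * (Real.pi / 2) = t + Real.pi := by push_cast; ring
    show co (fX t) (fY t) 2 x = fX (t + ((2 : ℕ) : ℝ) * (Real.pi / 2)) x
    rw [this, co2, fX, fX, Real.cos_add_pi, Real.sin_add_pi]; ring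
  · have : t + ((3 : ℕ) : ℝ) * (Real.pi / 2) = t + Real.pi + Real.pi / 2 := by push_cast; ring
    show co (fX t) (fY t) 3 x = fX (t + ((3 : ℕ) : ℝ) * (Real.pi / 2)) x
    rw [this, co3, fX, fY, Real.cos_add_pi_div_two, Real.sin_add_pi_div_two, Real.cos_add_pi,
      Real.sin_add_pi]; ring

lemma frame_drawing (P W : Finset Pt) (c : Pt → Fin 4)
    (hG : GenPos ((P : Set Pt) ∪ (W : Set Pt))) (hD : Drawing P W c)
    (h3 : ∀ i, ∃ x ∈ P, ∃ y ∈ P, ∃ z ∈ P, c x = i ∧ c y = i ∧ c z = i ∧ x ≠ y ∧ x ≠ z ∧ y ≠ z) (t : ℝ) :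
    (∀ i, ∃ k, StrictAt (P : Set Pt) c (fX t) (fY t) i k) ∧
      ∀ k, ∃ i, StrictAt (P : Set Pt) c (fX t) (fY t) i k := by
  apply frame_lemma (P : Set Pt) c (fX t) (fY t) (fun x _ y _ => finj t x y)
  · intro k x hx y hy z hz xy xz yz e1 e2
    apply hG.1 x (Or.inl hx) y (Or.inl hy) z (Or.inl hz) xy xz yz
    rw [f_shift, f_shift] at e1 e2
    refine fcr (t + (k : ℕ) * (Real.pi / 2)) x y z ?_ xy
    rw [e1] at e2 ⊢
    rw [← e2]; ring
  · intro z0 m0 z1 m1 z2 m2 z3 m3 hx hy e1 e2 e3 e4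
    have n : ∀ x y : Pt, (fX t x ≠ fX t y ∨ fY t x ≠ fY t y) → x ≠ y := by
      rintro x y h rfl; simp at h
    apply hG.2 z0 (Or.inl m0) z1 (Or.inl m1) z2 (Or.inl m2) z3 (Or.inl m3)
    · exact n _ _ (Or.inl hx.ne)
    · exact n _ _ (Or.inr hy.ne)
    · exact n _ _ (Or.inr (by rw [e4]; exact hy.ne))
    · exact n _ _ (Or.inr (by rw [e3]; exact hy.ne))
    · exact n _ _ (Or.inl (by rw [e1]; exact hx.ne'))
    · exact n _ _ (Or.inl (by rw [e1, e2]; exact hx.ne'))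
    · refine ⟨midpoint ℝ z0 z2, dist z0 z2 / 2, ?_⟩
      intro p hp
      apply on_circle
      rw [← fdot t]
      simp only [Set.mem_insert_iff, Set.mem_singleton_iff] at hp
      rcases hp with rfl | rfl | rfl | rfl
      · ring
      · rw [e2, e3]; ring
      · ring
      · rw [e1, e4]; ring
  · obtain ⟨x, hx, y, hy, z, hz, -, -, -, a, b, c⟩ := h3 0
    exact ⟨x, hx, y, hy, z, hz, a, b, c⟩
  · intro i
    obtain ⟨x, hx, y, hy, z, hz, cx, cy, cz, a, b, d⟩ := h3 i
    have pr := pair_of_drawing P W c hG hD (fX t) (fY t) (fdot t) (fcr t) (finj t)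
    have := class_lemma (P : Set Pt) c (fX t) (fY t) (fun x _ y _ => finj t x y) x y z hx hy hz
      (cx.trans cy.symm) (cy.trans cz.symm) (pr x y hx hy a (cx.trans cy.symm))
      (pr y z hy hz d (cy.trans cz.symm)) (pr z x hz hx b.symm (cz.trans cx.symm))
    rwa [cx] at this

/-- directions owned by class `i` -/
def Own (P : Finset Pt) (c : Pt → Fin 4) (i : Fin 4) : Set ℝ :=
  {t | ∃ a ∈ P, c a = i ∧ ∀ x ∈ P, c x ≠ i → fX t a < fX t x}

lemma own_open (P : Finset Pt) (c : Pt → Fin 4) (i : Fin 4) : IsOpen (Own P c i) := by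
  have : Own P c i = ⋃ a ∈ {a | a ∈ P ∧ c a = i}, ⋂ x ∈ {x | x ∈ P ∧ c x ≠ i}, {t | fX t a < fX t x} := by
    ext t
    simp only [Own, Set.mem_ofPred_eq, Set.mem_iUnion, Set.mem_iInter]
    constructor
    · rintro ⟨a, ha, ca, h⟩; exact ⟨a, ⟨ha, ca⟩, fun x hx => h x hx.1 hx.2⟩
    · rintro ⟨a, ⟨ha, ca⟩, h⟩; exact ⟨a, ha, ca, fun x hx cx => h x ⟨hx, cx⟩⟩
  rw [this]
  refine isOpen_biUnion fun a _ => Set.Finite.isOpen_biInter ?_ fun x _ => ?_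
  · exact P.finite_toSet.subset fun x hx => hx.1
  · apply isOpen_lt <;> unfold fX <;> fun_prop

lemma own_iff (P : Finset Pt) (c : Pt → Fin 4) (i k : Fin 4) (t : ℝ)
    (h : StrictAt (P : Set Pt) c (fX t) (fY t) i k) : t + (k : ℕ) * (Real.pi / 2) ∈ Own P c i := by
  obtain ⟨a, ha, ca, h⟩ := h
  refine ⟨a, ha, ca, fun x hx cx => ?_⟩
  rw [← f_shift, ← f_shift]
  exact h x hx cx

lemma own_disj (P : Finset Pt) (c : Pt → Fin 4) (i j : Fin 4) (t : ℝ) (hi : t ∈ Own P c i)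
    (hj : t ∈ Own P c j) : i = j := by
  by_contra hij
  obtain ⟨a, ha, ca, h1⟩ := hi
  obtain ⟨b, hb, cb, h2⟩ := hj
  have := h1 b hb (by rw [cb]; exact Ne.symm hij)
  have := h2 a ha (by rw [ca]; exact hij)
  linarith

lemma no_drawing (P W : Finset Pt) (c : Pt → Fin 4)
    (hG : GenPos ((P : Set Pt) ∪ (W : Set Pt))) (hD : Drawing P W c)
    (h3 : ∀ i, ∃ x ∈ P, ∃ y ∈ P, ∃ z ∈ P, c x = i ∧ c y = i ∧ c z = i ∧ x ≠ y ∧ x ≠ z ∧ y ≠ z) :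
    False := by
  have F := frame_drawing P W c hG hD h3
  have ne : ∀ i, (Own P c i).Nonempty := by
    intro i
    obtain ⟨k, hk⟩ := (F 0).1 i
    exact ⟨_, own_iff P c i k 0 hk⟩
  have cov : ∀ t, ∃ i, t ∈ Own P c i := by
    intro t
    obtain ⟨i, hi⟩ := (F t).2 0
    have := own_iff P c i 0 t hi
    exact ⟨i, by simpa using this⟩
  have hpre : IsPreconnected (Set.univ : Set ℝ) := isPreconnected_univ
  obtain ⟨t, -, h0, h1⟩ := hpre (Own P c 0) (⋃ i ∈ {i : Fin 4 | i ≠ 0}, Own P c i) (own_open P c 0)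
    (isOpen_biUnion fun i _ => own_open P c i)
    (by
      intro t _
      obtain ⟨i, hi⟩ := cov t
      by_cases h : i = 0
      · left; rw [← h]; exact hi
      · right; exact Set.mem_biUnion (x := i) h hi)
    (by simpa using ne 0)
    (by
      obtain ⟨t, ht⟩ := ne 1
      exact ⟨t, trivial, Set.mem_biUnion (x := (1 : Fin 4)) (by simp) ht⟩)
  obtain ⟨i, hi, hit⟩ := Set.mem_iUnion₂.mp h1
  exact hi (own_disj P c i 0 t hit h0)

/-- For `p,q,r,s ≥ 3` there is no witness Gabriel drawing of `K_{p,q,r,s}`. -/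
theorem no_witness_gabriel_drawing_Kpqrs
    (p q r s : ℕ) (hp : 3 ≤ p) (hq : 3 ≤ q) (hr : 3 ≤ r) (hs : 3 ≤ s) :
    ¬ ∃ (P W : Finset Pt) (c : Pt → Fin 4),
        GenPos ((P : Set Pt) ∪ (W : Set Pt)) ∧
        (P.filter (fun x => c x = 0)).card = p ∧
        (P.filter (fun x => c x = 1)).card = q ∧
        (P.filter (fun x => c x = 2)).card = r ∧
        (P.filter (fun x => c x = 3)).card = s ∧
        (∀ a ∈ P, ∀ b ∈ P, a ≠ b →
          (gabrielEdge (W : Set Pt) a b ↔ c a ≠ c b)) := by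
  rintro ⟨P, W, c, hG, h0, h1, h2, h3, hD⟩
  have key : ∀ i, 3 ≤ (P.filter (fun x => c x = i)).card := by
    intro i
    fin_cases i
    · exact h0 ▸ hp
    · exact h1 ▸ hq
    · exact h2 ▸ hr
    · exact h3 ▸ hs
  refine no_drawing P W c hG hD fun i => ?_
  obtain ⟨x, y, z, hx, hy, hz, xy, xz, yz⟩ := Finset.two_lt_card_iff.mp (key i)
  rw [Finset.mem_filter] at hx hy hz
  exact ⟨x, hx.1, y, hy.1, z, hz.1, hx.2, hy.2, hz.2, xy, xz, yz⟩
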